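/- For every real r > 1 there exists a constant c_r > 0 such that for all positive integers k, ℓ, m the following holds: let n = ℓ(k+m)+1 and consider the discrete-time Moran process with fitness r on the (k,ℓ,m)-superstar, started from a single initial mutant placed at a uniformly random vertex; then its extinction probability is at least 1/(c_r·(n·log n)^{1/3}). -/

import Mathlib

open Finset

/-- Total fitness of the mutant set `S` (mutants have fitness `r`, non-mutants fitness `1`). -/
noncomputable def moranW {V : Type*} [Fintype V] (r : ℝ) (S : Finset V) : ℝ :=
  r * S.card + ((Fintype.card V : ℝ) - S.card)

/-- One-step transition probability of the Moran process with fitness `r` and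
reproduction weights `w`, from mutant set `S` to mutant set `T`:  a vertex `u` is chosen
with probability `r / moranW r S` if it is a mutant and `1 / moranW r S` otherwise, then a
target `v` is chosen with probability `w u v`, and `v` becomes a mutant if `u` is one and
a non-mutant otherwise. -/
noncomputable def moranStep {V : Type*} [Fintype V] [DecidableEq V]
    (r : ℝ) (w : V → V → ℝ) (S T : Finset V) : ℝ :=
  ∑ u : V, ∑ v : V,
    ((if u ∈ S then r else 1) / moranW r S) * w u v *
      (if (if u ∈ S then insert v S else S.erase v) = T then 1 else 0)

/-- Distribution of the Moran process after `t` steps, from initial distribution `init`. -/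
noncomputable def moranDist {V : Type*} [Fintype V] [DecidableEq V]
    (r : ℝ) (w : V → V → ℝ) (init : Finset V → ℝ) : ℕ → Finset V → ℝ
  | 0 => init
  | t + 1 => fun T => ∑ S : Finset V, moranDist r w init t S * moranStep r w S T

/-- Reproduction weights of the (unweighted) Moran process on the digraph with
out-neighbourhoods `out`: the offspring goes to a uniformly random out-neighbour. -/
noncomputable def outWeights {V : Type*} [DecidableEq V]
    (out : V → Finset V) : V → V → ℝ :=
  fun u v => if v ∈ out u then ((out u).card : ℝ)⁻¹ else 0

/-- Extinction probability: `sup_t Pr(S_t = ∅)`. -/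
noncomputable def extinctionProb {V : Type*} [Fintype V] [DecidableEq V]
    (r : ℝ) (w : V → V → ℝ) (init : Finset V → ℝ) : ℝ :=
  ⨆ t : ℕ, moranDist r w init t (∅ : Finset V)

/-- Fixation probability: `sup_t Pr(S_t = V)`. -/
noncomputable def fixationProb {V : Type*} [Fintype V] [DecidableEq V]
    (r : ℝ) (w : V → V → ℝ) (init : Finset V → ℝ) : ℝ :=
  ⨆ t : ℕ, moranDist r w init t (Finset.univ : Finset V)

/-- Initial distribution: a single mutant at a uniformly random vertex. -/
noncomputable def uniformSingleton (V : Type*) [Fintype V] [DecidableEq V] :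
    Finset V → ℝ :=
  fun S => if S.card = 1 then (Fintype.card V : ℝ)⁻¹ else 0

/-- Initial distribution: a single mutant at the fixed vertex `x₀`. -/
def pointInit {V : Type*} [DecidableEq V] (x₀ : V) : Finset V → ℝ :=
  fun S => if S = {x₀} then 1 else 0

/-- Vertices of the `(k,ℓ,m)`-superstar: `ℓ` reservoirs `R_i` of size `m`
(`Sum.inl (i, x)`), path vertices `v_{i,j}` for `i ∈ [ℓ]`, `j ∈ [k]`
(`Sum.inr (Sum.inl (i, j))`), and the centre vertex `v*` (`Sum.inr (Sum.inr ())`).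
It has `ℓ * (k + m) + 1` vertices. -/
abbrev SuperstarV (k ℓ m : ℕ) : Type :=
  (Fin ℓ × Fin m) ⊕ ((Fin ℓ × Fin k) ⊕ Unit)

/-- Out-neighbourhoods of the `(k,ℓ,m)`-superstar: the centre points to every reservoir
vertex, each vertex of `R_i` points to `v_{i,1}`, each `v_{i,j}` points to `v_{i,j+1}`
for `j < k`, and `v_{i,k}` points to the centre. -/
def superstarOut (k ℓ m : ℕ) : SuperstarV k ℓ m → Finset (SuperstarV k ℓ m)
  | Sum.inl (i, _) =>
      if h : 0 < k then {Sum.inr (Sum.inl (i, ⟨0, h⟩))} else {Sum.inr (Sum.inr ())}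
  | Sum.inr (Sum.inl (i, j)) =>
      if h : (j : ℕ) + 1 < k then {Sum.inr (Sum.inl (i, ⟨(j : ℕ) + 1, h⟩))}
      else {Sum.inr (Sum.inr ())}
  | Sum.inr (Sum.inr _) =>
      (Finset.univ : Finset (Fin ℓ × Fin m)).image fun p => Sum.inl p

/-- The state after `u` reproduces onto `v`. -/
def mNext {V : Type*} [DecidableEq V] (S : Finset V) (u v : V) : Finset V :=
  if u ∈ S then insert v S else S.erase v

/-- The unnormalised drift of `g` at `S`. -/
noncomputable def mDrift {V : Type*} [Fintype V] [DecidableEq V]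
    (r : ℝ) (w : V → V → ℝ) (g : Finset V → ℝ) (S : Finset V) : ℝ :=
  ∑ u : V, (if u ∈ S then r else 1) * ∑ v : V, w u v * (g (mNext S u v) - g S)

section general
variable {V : Type*} [Fintype V] [DecidableEq V]

lemma moranW_eq (r : ℝ) (S : Finset V) :
    moranW r S = ∑ u : V, (if u ∈ S then r else 1) := by
  rw [Finset.sum_ite]
  simp only [moranW, Finset.sum_const, nsmul_eq_mul, mul_one, Finset.filter_univ_mem]
  have h : (Finset.univ.filter (fun u => u ∉ S)) = Sᶜ := by ext; simp
  rw [h, Finset.card_compl, Nat.cast_sub (Finset.card_le_univ S)]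
  ring

lemma moranW_pos [Nonempty V] {r : ℝ} (hr : 0 < r) (S : Finset V) : 0 < moranW r S := by
  rw [moranW_eq]
  apply Finset.sum_pos
  · intro u _
    split_ifs <;> linarith
  · exact Finset.univ_nonempty

lemma step_apply (r : ℝ) (w : V → V → ℝ) (g : Finset V → ℝ) (S : Finset V) :
    ∑ T, moranStep r w S T * g T =
      ∑ u : V, ∑ v : V, ((if u ∈ S then r else 1) / moranW r S) * w u v * g (mNext S u v) := by
  simp only [moranStep, Finset.sum_mul]
  rw [Finset.sum_comm]
  refine Finset.sum_congr rfl fun u _ => ?_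
  rw [Finset.sum_comm]
  refine Finset.sum_congr rfl fun v _ => ?_
  rw [Finset.sum_eq_single (mNext S u v)]
  · simp [mNext]
  · intro T _ hT
    have : ¬ ((if u ∈ S then insert v S else S.erase v) = T) := fun h => hT h.symm
    rw [if_neg this]; ring
  · simp

lemma step_drift [Nonempty V] {r : ℝ} (hr : 0 < r) (w : V → V → ℝ) (hw : ∀ u, ∑ v, w u v = 1)
    (g : Finset V → ℝ) (S : Finset V) :
    ∑ T, moranStep r w S T * g T = g S + mDrift r w g S / moranW r S := by
  have hW := moranW_pos (V := V) hr S
  rw [step_apply]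
  have h1 : mDrift r w g S = (∑ u : V, (if u ∈ S then r else 1) * ∑ v : V, w u v * g (mNext S u v))
      - moranW r S * g S := by
    rw [moranW_eq, Finset.sum_mul, ← Finset.sum_sub_distrib]
    refine Finset.sum_congr rfl fun u _ => ?_
    simp only [mul_sub, Finset.sum_sub_distrib, ← Finset.sum_mul, hw]
    ring
  rw [h1, sub_div, mul_div_cancel_left₀ _ hW.ne', Finset.sum_div]
  rw [add_sub_cancel]
  refine Finset.sum_congr rfl fun u _ => ?_
  rw [Finset.mul_sum, Finset.sum_div]
  refine Finset.sum_congr rfl fun v _ => ?_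
  ring

lemma step_nonneg [Nonempty V] {r : ℝ} (hr : 0 < r) {w : V → V → ℝ} (hw0 : ∀ u v, 0 ≤ w u v)
    (S T : Finset V) : 0 ≤ moranStep r w S T := by
  have hW := moranW_pos (V := V) hr S
  unfold moranStep
  refine Finset.sum_nonneg fun u _ => Finset.sum_nonneg fun v _ => ?_
  have := hw0 u v
  apply mul_nonneg
  · apply mul_nonneg _ this
    apply div_nonneg _ hW.le
    split_ifs <;> linarith
  · split_ifs <;> norm_num

lemma step_sum [Nonempty V] {r : ℝ} (hr : 0 < r) (w : V → V → ℝ) (hw : ∀ u, ∑ v, w u v = 1)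
    (S : Finset V) : ∑ T, moranStep r w S T = 1 := by
  have := step_drift hr w hw (fun _ => 1) S
  simpa [mDrift] using this

lemma dist_nonneg' [Nonempty V] {r : ℝ} (hr : 0 < r) {w : V → V → ℝ} (hw0 : ∀ u v, 0 ≤ w u v)
    {init : Finset V → ℝ} (hi : ∀ S, 0 ≤ init S) (t : ℕ) (S : Finset V) :
    0 ≤ moranDist r w init t S := by
  induction t generalizing S with
  | zero => exact hi S
  | succ t ih => exact Finset.sum_nonneg fun T _ => mul_nonneg (ih T) (step_nonneg hr hw0 _ _)

lemma dist_apply (r : ℝ) (w : V → V → ℝ) (init : Finset V → ℝ) (g : Finset V → ℝ) (t : ℕ) :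
    ∑ T, moranDist r w init (t + 1) T * g T
      = ∑ S, moranDist r w init t S * ∑ T, moranStep r w S T * g T := by
  simp only [moranDist, Finset.sum_mul, Finset.mul_sum]
  rw [Finset.sum_comm]
  refine Finset.sum_congr rfl fun u _ => Finset.sum_congr rfl fun v _ => ?_
  ring

lemma dist_sum [Nonempty V] {r : ℝ} (hr : 0 < r) (w : V → V → ℝ) (hw : ∀ u, ∑ v, w u v = 1)
    {init : Finset V → ℝ} (hi : ∑ S, init S = 1) (t : ℕ) :
    ∑ S, moranDist r w init t S = 1 := by
  induction t with
  | zero => exact hi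
  | succ t ih =>
    have := dist_apply r w init (fun _ => 1) t
    simp only [mul_one, step_sum hr w hw] at this
    rw [this, ih]

lemma dist_le_one [Nonempty V] {r : ℝ} (hr : 0 < r) {w : V → V → ℝ} (hw0 : ∀ u v, 0 ≤ w u v)
    (hw : ∀ u, ∑ v, w u v = 1)
    {init : Finset V → ℝ} (hi0 : ∀ S, 0 ≤ init S) (hi : ∑ S, init S = 1) (t : ℕ) (S : Finset V) :
    moranDist r w init t S ≤ 1 := by
  rw [← dist_sum hr w hw hi t]
  exact Finset.single_le_sum (f := moranDist r w init t)
    (fun T _ => dist_nonneg' hr hw0 hi0 t T) (Finset.mem_univ S)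

lemma drift_empty (r : ℝ) (w : V → V → ℝ) (g : Finset V → ℝ) : mDrift r w g ∅ = 0 := by
  simp [mDrift, mNext]

lemma dist_mono [Nonempty V] {r : ℝ} (hr : 0 < r) {w : V → V → ℝ} (hw0 : ∀ u v, 0 ≤ w u v)
    (hw : ∀ u, ∑ v, w u v = 1)
    {init : Finset V → ℝ} (hi0 : ∀ S, 0 ≤ init S) :
    Monotone fun t => moranDist r w init t ∅ := by
  apply monotone_nat_of_le_succ
  intro t
  have h1 := step_drift hr w hw (fun T => if T = ∅ then 1 else 0) (∅ : Finset V)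
  rw [drift_empty] at h1
  simp at h1
  have h2 : moranDist r w init (t + 1) ∅ = ∑ S, moranDist r w init t S * moranStep r w S ∅ := rfl
  rw [h2]
  have h3 := Finset.single_le_sum (f := fun S => moranDist r w init t S * moranStep r w S ∅)
    (fun T _ => mul_nonneg (dist_nonneg' hr hw0 hi0 t T) (step_nonneg hr hw0 _ _))
    (Finset.mem_univ (∅ : Finset V))
  simpa [h1] using h3

/-- Potential function method. -/
lemma ext_ge [Nonempty V] {r : ℝ} (hr : 0 < r) {w : V → V → ℝ} (hw0 : ∀ u v, 0 ≤ w u v)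
    (hw : ∀ u, ∑ v, w u v = 1)
    {init : Finset V → ℝ} (hi0 : ∀ S, 0 ≤ init S) (hi : ∑ S, init S = 1)
    (g : Finset V → ℝ) (g0 : ∀ S, 0 ≤ g S) (g1 : ∀ S, g S ≤ 1)
    (hg : ∀ S, S ≠ ∅ → 0 < g S → 0 < mDrift r w g S) :
    ∑ S, init S * g S ≤ extinctionProb r w init := by
  have hbdd : BddAbove (Set.range fun t => moranDist r w init t ∅) :=
    ⟨1, by rintro _ ⟨t, rfl⟩; exact dist_le_one hr hw0 hw hi0 hi t ∅⟩
  by_contra hcon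
  push Not at hcon
  set e := extinctionProb r w init with he
  have hle : ∀ t, moranDist r w init t ∅ ≤ e := fun t => le_ciSup hbdd t
  -- uniform drift
  obtain ⟨δ, hδ, hδ'⟩ : ∃ δ : ℝ, 0 < δ ∧ ∀ S, S ≠ ∅ → 0 < g S →
      δ ≤ mDrift r w g S / moranW r S := by
    obtain ⟨S0, -, hS0⟩ := Finset.exists_min_image (Finset.univ : Finset (Finset V))
      (fun S => if S ≠ ∅ ∧ 0 < g S then mDrift r w g S / moranW r S else 1)
      Finset.univ_nonempty
    refine ⟨if S0 ≠ ∅ ∧ 0 < g S0 then mDrift r w g S0 / moranW r S0 else 1, ?_, fun S h1 h2 => ?_⟩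
    · split_ifs with h
      · exact div_pos (hg _ h.1 h.2) (moranW_pos hr _)
      · norm_num
    · have := hS0 S (Finset.mem_univ _)
      rwa [if_pos (show S ≠ ∅ ∧ 0 < g S from ⟨h1, h2⟩)] at this
  have hstep : ∀ S, g S + δ * (g S - if S = ∅ then 1 else 0) ≤ ∑ T, moranStep r w S T * g T := by
    intro S
    rw [step_drift hr w hw]
    by_cases hS : S = ∅
    · subst hS
      rw [drift_empty]
      have := g1 ∅
      simp
      nlinarith
    · rw [if_neg hS]
      rcases (g0 S).lt_or_eq with h | h
      · have := hδ' S hS h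
        have := g1 S
        nlinarith
      · rw [← h]
        have hd : 0 ≤ mDrift r w g S := by
          unfold mDrift
          refine Finset.sum_nonneg fun u _ => mul_nonneg (by split_ifs <;> linarith)
            (Finset.sum_nonneg fun v _ => mul_nonneg (hw0 u v) ?_)
          rw [← h]; have := g0 (mNext S u v); linarith
        have := div_nonneg hd (moranW_pos (V := V) hr S).le
        linarith
  have hE : ∀ t, (∑ S, moranDist r w init t S * g S)
      + δ * ((∑ S, moranDist r w init t S * g S) - moranDist r w init t ∅)
      ≤ ∑ S, moranDist r w init (t + 1) S * g S := by
    intro t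
    rw [dist_apply]
    have h1 : ∀ S, moranDist r w init t S * (g S + δ * (g S - if S = ∅ then 1 else 0)) ≤
        moranDist r w init t S * ∑ T, moranStep r w S T * g T :=
      fun S => mul_le_mul_of_nonneg_left (hstep S) (dist_nonneg' hr hw0 hi0 t S)
    refine le_trans (le_of_eq ?_) (Finset.sum_le_sum fun S _ => h1 S)
    have h2 : moranDist r w init t ∅ =
        ∑ S, moranDist r w init t S * (if S = ∅ then 1 else 0) := by simp
    rw [h2, ← Finset.sum_sub_distrib, Finset.mul_sum, ← Finset.sum_add_distrib]
    refine Finset.sum_congr rfl fun S _ => ?_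
    ring
  set E0 := ∑ S, init S * g S with hE0
  have hlow : ∀ t : ℕ, E0 + t * (δ * (E0 - e)) ≤ ∑ S, moranDist r w init t S * g S := by
    intro t
    induction t with
    | zero => simp [moranDist, hE0]
    | succ t ih =>
      have h1 := hE t
      have h2 := hle t
      have h4 : 0 ≤ δ * (E0 - e) := mul_nonneg hδ.le (by linarith)
      have h3 : E0 ≤ ∑ S, moranDist r w init t S * g S := by
        have : 0 ≤ (t : ℝ) * (δ * (E0 - e)) := mul_nonneg (Nat.cast_nonneg _) h4
        linarith
      have h5 : δ * (E0 - e) ≤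
          δ * ((∑ S, moranDist r w init t S * g S) - moranDist r w init t ∅) :=
        mul_le_mul_of_nonneg_left (by linarith) hδ.le
      push_cast
      linarith
  have hup : ∀ t : ℕ, ∑ S, moranDist r w init t S * g S ≤ 1 := by
    intro t
    rw [← dist_sum hr w hw hi t]
    exact Finset.sum_le_sum fun S _ =>
      mul_le_of_le_one_right (dist_nonneg' hr hw0 hi0 t S) (g1 S)
  have hpos : 0 < δ * (E0 - e) := mul_pos hδ (by linarith)
  obtain ⟨t, ht⟩ := exists_nat_gt ((1 - E0) / (δ * (E0 - e)))
  rw [div_lt_iff₀ hpos] at ht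
  have := hlow t
  have := hup t
  linarith

lemma uniform_ext [Nonempty V] {r : ℝ} (hr : 0 < r) {w : V → V → ℝ} (hw0 : ∀ u v, 0 ≤ w u v)
    (hw : ∀ u, ∑ v, w u v = 1) :
    (Fintype.card V : ℝ)⁻¹ * ∑ x : V, extinctionProb r w (pointInit x)
      ≤ extinctionProb r w (uniformSingleton V) := by
  have hp0 : ∀ x : V, ∀ S, 0 ≤ pointInit x S := by
    intro x S; unfold pointInit; split_ifs <;> norm_num
  have hp1 : ∀ x : V, ∑ S, pointInit x S = 1 := by
    intro x; simp [pointInit]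
  have hu : ∀ S : Finset V, uniformSingleton V S
      = (Fintype.card V : ℝ)⁻¹ * ∑ x : V, pointInit x S := by
    intro S
    unfold uniformSingleton pointInit
    split_ifs with h
    · obtain ⟨x, rfl⟩ := Finset.card_eq_one.1 h
      simp
    · rw [Finset.sum_eq_zero]; · simp
      intro x _
      rw [if_neg]
      rintro rfl; simp at h
  have hu0 : ∀ S, 0 ≤ uniformSingleton V S := by
    intro S; rw [hu]
    exact mul_nonneg (by positivity) (Finset.sum_nonneg fun x _ => hp0 x S)
  have hu1 : ∑ S, uniformSingleton V S = 1 := by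
    simp only [hu]
    rw [← Finset.mul_sum, Finset.sum_comm]
    simp [hp1]
  have hd : ∀ t S, moranDist r w (uniformSingleton V) t S
      = (Fintype.card V : ℝ)⁻¹ * ∑ x : V, moranDist r w (pointInit x) t S := by
    intro t
    induction t with
    | zero => exact hu
    | succ t ih =>
      intro S
      simp only [moranDist, ih]
      rw [Finset.sum_comm (γ := V), Finset.mul_sum]
      refine Finset.sum_congr rfl fun T _ => ?_
      rw [← Finset.sum_mul]; ring
  have hlim : Filter.Tendsto (fun t => moranDist r w (uniformSingleton V) t ∅) Filter.atTop
      (nhds ((Fintype.card V : ℝ)⁻¹ * ∑ x : V, extinctionProb r w (pointInit x))) := by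
    simp only [hd]
    refine Filter.Tendsto.const_mul _ (tendsto_finsetSum _ fun x _ => ?_)
    exact tendsto_atTop_ciSup (dist_mono hr hw0 hw (hp0 x))
      ⟨1, by rintro _ ⟨t, rfl⟩; exact dist_le_one hr hw0 hw (hp0 x) (hp1 x) t ∅⟩
  refine le_of_tendsto' hlim fun t => ?_
  exact le_ciSup (f := fun t => moranDist r w (uniformSingleton V) t ∅)
    ⟨1, by rintro _ ⟨t, rfl⟩; exact dist_le_one hr hw0 hw hu0 hu1 t ∅⟩ t

lemma point_ext_ge [Nonempty V] {r : ℝ} (hr : 0 < r) {w : V → V → ℝ} (hw0 : ∀ u v, 0 ≤ w u v)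
    (hw : ∀ u, ∑ v, w u v = 1) (x : V)
    (g : Finset V → ℝ) (g0 : ∀ S, 0 ≤ g S) (g1 : ∀ S, g S ≤ 1)
    (hg : ∀ S, S ≠ ∅ → 0 < g S → 0 < mDrift r w g S) :
    g {x} ≤ extinctionProb r w (pointInit x) := by
  have := ext_ge hr hw0 hw (init := pointInit x)
    (by intro S; unfold pointInit; split_ifs <;> norm_num) (by simp [pointInit]) g g0 g1 hg
  simpa [pointInit] using this

end general

section superstar
variable {k ℓ m : ℕ}

/-- Path vertex. -/
abbrev pv (i : Fin ℓ) (j : Fin k) : SuperstarV k ℓ m := Sum.inr (Sum.inl (i, j))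
/-- Reservoir vertex. -/
abbrev rv (p : Fin ℓ × Fin m) : SuperstarV k ℓ m := Sum.inl p
/-- Centre vertex. -/
abbrev cv : SuperstarV k ℓ m := Sum.inr (Sum.inr ())

lemma ow_sum {V : Type*} [Fintype V] [DecidableEq V] (out : V → Finset V) (u : V) (F : V → ℝ) :
    ∑ v, outWeights out u v * F v = ((out u).card : ℝ)⁻¹ * ∑ v ∈ out u, F v := by
  simp only [outWeights, ite_mul, zero_mul]
  rw [Finset.sum_ite_mem, Finset.univ_inter, Finset.mul_sum]

lemma out_rv (hk : 0 < k) (p : Fin ℓ × Fin m) :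
    superstarOut k ℓ m (rv p) = {pv p.1 ⟨0, hk⟩} := by
  obtain ⟨i, y⟩ := p
  simp [superstarOut, hk]

/-- Target of a path vertex. -/
def ptgt (i : Fin ℓ) (j : Fin k) : SuperstarV k ℓ m :=
  if h : (j : ℕ) + 1 < k then pv i ⟨(j : ℕ) + 1, h⟩ else cv

lemma out_pv (i : Fin ℓ) (j : Fin k) :
    superstarOut k ℓ m (pv i j) = {ptgt i j} := by
  simp only [superstarOut, ptgt]
  split_ifs <;> rfl

lemma ow_nonneg (u v : SuperstarV k ℓ m) : 0 ≤ outWeights (superstarOut k ℓ m) u v := by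
  unfold outWeights; split_ifs <;> positivity

lemma ow_cv (F : SuperstarV k ℓ m → ℝ) :
    ∑ v, outWeights (superstarOut k ℓ m) cv v * F v
      = ((ℓ : ℝ) * m)⁻¹ * ∑ p : Fin ℓ × Fin m, F (rv p) := by
  rw [ow_sum]
  have hinj : Function.Injective (fun p : Fin ℓ × Fin m => (Sum.inl p : SuperstarV k ℓ m)) :=
    Sum.inl_injective
  simp only [superstarOut]
  rw [Finset.card_image_of_injective _ hinj, Finset.sum_image (fun a _ b _ h => hinj h)]
  simp

lemma ow_one (hk : 0 < k) (hl : 0 < ℓ) (hm : 0 < m) (u : SuperstarV k ℓ m) :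
    ∑ v, outWeights (superstarOut k ℓ m) u v = 1 := by
  rcases u with p | ⟨i, j⟩ | ⟨⟩
  · have := ow_sum (superstarOut k ℓ m) (rv p) (fun _ => 1)
    rw [out_rv hk] at this
    simpa using this
  · have := ow_sum (superstarOut k ℓ m) (pv i j) (fun _ => 1)
    rw [out_pv] at this
    simpa using this
  · have := ow_cv (k := k) (ℓ := ℓ) (m := m) (fun _ => 1)
    simp only [mul_one] at this
    rw [this]
    have h1 : (ℓ : ℝ) ≠ 0 := by positivity
    have h2 : (m : ℝ) ≠ 0 := by positivity
    simp
    field_simp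

lemma drift_formula (hk : 0 < k) (r : ℝ) (g : Finset (SuperstarV k ℓ m) → ℝ)
    (S : Finset (SuperstarV k ℓ m)) :
    mDrift r (outWeights (superstarOut k ℓ m)) g S =
      (∑ p : Fin ℓ × Fin m, (if rv p ∈ S then r else 1)
        * (g (mNext S (rv p) (pv p.1 ⟨0, hk⟩)) - g S))
      + ((∑ i : Fin ℓ, ∑ j : Fin k, (if pv i j ∈ S then r else 1)
        * (g (mNext S (pv i j) (ptgt i j)) - g S))
      + (if cv ∈ S then r else 1) * (((ℓ : ℝ) * m)⁻¹
        * ∑ p : Fin ℓ × Fin m, (g (mNext S cv (rv p)) - g S))) := by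
  unfold mDrift
  rw [Fintype.sum_sum_type, Fintype.sum_sum_type]
  congr 1
  · refine Finset.sum_congr rfl fun p _ => ?_
    rw [ow_sum, out_rv hk]; simp
  congr 1
  · rw [Fintype.sum_prod_type]
    refine Finset.sum_congr rfl fun i _ => Finset.sum_congr rfl fun j _ => ?_
    rw [ow_sum, out_pv]; simp
  · simp only [Finset.univ_unique, Finset.sum_singleton]
    rw [ow_cv]

/-- Bound (A): a single mutant on a path. -/
lemma path_ext (hk : 0 < k) (hl : 0 < ℓ) (hm : 0 < m) {r : ℝ} (hr : 1 < r) (i : Fin ℓ)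
    (j : Fin k) :
    1 / (2 + r) ≤ extinctionProb r (outWeights (superstarOut k ℓ m)) (pointInit (pv i j)) := by
  have : Nonempty (SuperstarV k ℓ m) := ⟨cv⟩
  have hr0 : 0 < r := by linarith
  set b : ℝ := 1 / (2 + r) with hb
  have hb0 : 0 < b := by positivity
  have hb1 : b * (2 + r) = 1 := by rw [hb]; field_simp
  have hb2 : b < 1 := by nlinarith
  set g : Finset (SuperstarV k ℓ m) → ℝ :=
    fun S => if S = ∅ then 1 else if S = {pv i j} then b else 0 with hg
  have hgx : g {pv i j} = b := by simp [hg]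
  have hge : g ∅ = 1 := by simp [hg]
  have g0 : ∀ S, 0 ≤ g S := by
    intro S; simp only [hg]; split_ifs <;> linarith
  rw [← hgx]
  refine point_ext_ge hr0 ow_nonneg (ow_one hk hl hm) (pv i j) g g0 ?_ ?_
  · intro S; simp only [hg]; split_ifs <;> linarith
  · intro S hS hpos
    have hSx : S = {pv i j} := by
      by_contra h
      simp [hg, hS, h] at hpos
    subst hSx
    rw [drift_formula hk, hgx]
    -- nonmutant moves are nonnegative
    have her : ∀ v, 0 ≤ g (({pv i j} : Finset (SuperstarV k ℓ m)).erase v) - b := by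
      intro v
      by_cases hv : v = pv i j
      · subst hv
        simp [hge]; linarith
      · rw [Finset.erase_eq_of_notMem (by simpa using hv), hgx]; simp
    have her' : g (({pv i j} : Finset (SuperstarV k ℓ m)).erase (pv i j)) - b = 1 - b := by
      simp [hge]
    have hins : ∀ v, -b ≤ g (insert v ({pv i j} : Finset (SuperstarV k ℓ m))) - b := by
      intro v
      have := g0 (insert v ({pv i j} : Finset (SuperstarV k ℓ m)))
      linarith
    have hc : 0 ≤ (if (cv : SuperstarV k ℓ m) ∈ ({pv i j} : Finset (SuperstarV k ℓ m))
        then r else 1) * (((ℓ : ℝ) * m)⁻¹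
        * ∑ p : Fin ℓ × Fin m, (g (mNext {pv i j} cv (rv p)) - b)) := by
      have : (cv : SuperstarV k ℓ m) ∉ ({pv i j} : Finset (SuperstarV k ℓ m)) := by simp
      rw [if_neg this, one_mul]
      refine mul_nonneg (by positivity) (Finset.sum_nonneg fun p _ => ?_)
      unfold mNext
      rw [if_neg this]
      exact her _
    have hres : ∀ p : Fin ℓ × Fin m, (if rv p ∈ ({pv i j} : Finset (SuperstarV k ℓ m))
        then r else 1) * (g (mNext {pv i j} (rv p) (pv p.1 ⟨0, hk⟩)) - b) =
        g (({pv i j} : Finset (SuperstarV k ℓ m)).erase (pv p.1 ⟨0, hk⟩)) - b := by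
      intro p
      have : (rv p : SuperstarV k ℓ m) ∉ ({pv i j} : Finset (SuperstarV k ℓ m)) := by simp
      unfold mNext
      rw [if_neg this, if_neg this, one_mul]
    have hpne : ∀ i' j', (i', j') ≠ (i, j) →
        (if pv i' j' ∈ ({pv i j} : Finset (SuperstarV k ℓ m)) then r else 1)
        * (g (mNext {pv i j} (pv i' j') (ptgt i' j')) - b) =
        g (({pv i j} : Finset (SuperstarV k ℓ m)).erase (ptgt i' j')) - b := by
      intro i' j' hne
      have : (pv i' j' : SuperstarV k ℓ m) ∉ ({pv i j} : Finset (SuperstarV k ℓ m)) := by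
        simp at hne ⊢; exact hne
      unfold mNext
      rw [if_neg this, if_neg this, one_mul]
    have hpe : -(r * b) ≤
        (if pv i j ∈ ({pv i j} : Finset (SuperstarV k ℓ m)) then r else 1)
        * (g (mNext {pv i j} (pv i j) (ptgt i j)) - b) := by
      have : (pv i j : SuperstarV k ℓ m) ∈ ({pv i j} : Finset (SuperstarV k ℓ m)) := by simp
      unfold mNext
      rw [if_pos this, if_pos this]
      nlinarith [hins (ptgt i j)]
    rw [← Fintype.sum_prod_type' (f := fun i' j' =>
      (if pv i' j' ∈ ({pv i j} : Finset (SuperstarV k ℓ m)) then r else 1)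
        * (g (mNext {pv i j} (pv i' j') (ptgt i' j')) - b))]
    simp only [hres]
    by_cases hj : (j : ℕ) = 0
    · have hj' : j = ⟨0, hk⟩ := Fin.ext hj
      have h1 : 1 - b ≤ ∑ p : Fin ℓ × Fin m,
          (g (({pv i j} : Finset (SuperstarV k ℓ m)).erase (pv p.1 ⟨0, hk⟩)) - b) := by
        refine le_trans (le_of_eq ?_) (Finset.single_le_sum (fun p _ => her _)
          (Finset.mem_univ (i, (⟨0, hm⟩ : Fin m))))
        simp only
        rw [← hj', her']
      have h2 : -(r * b) ≤ ∑ x : Fin ℓ × Fin k,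
          (if pv x.1 x.2 ∈ ({pv i j} : Finset (SuperstarV k ℓ m)) then r else 1)
        * (g (mNext {pv i j} (pv x.1 x.2) (ptgt x.1 x.2)) - b) := by
        rw [← Finset.add_sum_erase _ _ (Finset.mem_univ (i, j))]
        have : 0 ≤ ∑ x ∈ Finset.univ.erase (i, j),
          (if pv x.1 x.2 ∈ ({pv i j} : Finset (SuperstarV k ℓ m)) then r else 1)
            * (g (mNext {pv i j} (pv x.1 x.2) (ptgt x.1 x.2)) - b) := by
          refine Finset.sum_nonneg fun x hx => ?_
          rw [hpne _ _ (Finset.ne_of_mem_erase hx)]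
          exact her _
        linarith
      nlinarith
    · have h1 : 0 ≤ ∑ p : Fin ℓ × Fin m,
          (g (({pv i j} : Finset (SuperstarV k ℓ m)).erase (pv p.1 ⟨0, hk⟩)) - b) :=
        Finset.sum_nonneg fun p _ => her _
      obtain ⟨j0, hj0⟩ : ∃ j0 : Fin k, (j0 : ℕ) + 1 = j :=
        ⟨⟨j - 1, by omega⟩, by simp; omega⟩
      have hne : (i, j0) ≠ (i, j) := by
        intro h
        have : j0 = j := (Prod.ext_iff.1 h).2
        rw [this] at hj0; omega
      have htg : (ptgt i j0 : SuperstarV k ℓ m) = pv i j := by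
        unfold ptgt
        rw [dif_pos (by omega)]
        congr
      have h2 : -(r * b) + (1 - b) ≤ ∑ x : Fin ℓ × Fin k,
          (if pv x.1 x.2 ∈ ({pv i j} : Finset (SuperstarV k ℓ m)) then r else 1)
        * (g (mNext {pv i j} (pv x.1 x.2) (ptgt x.1 x.2)) - b) := by
        rw [← Finset.add_sum_erase _ _ (Finset.mem_univ (i, j))]
        refine add_le_add hpe ?_
        have hz : ∀ x ∈ Finset.univ.erase (i, j), 0 ≤
          (if pv x.1 x.2 ∈ ({pv i j} : Finset (SuperstarV k ℓ m)) then r else 1)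
            * (g (mNext {pv i j} (pv x.1 x.2) (ptgt x.1 x.2)) - b) := by
          intro x hx
          rw [hpne _ _ (Finset.ne_of_mem_erase hx)]
          exact her _
        refine le_trans (le_of_eq ?_) (Finset.single_le_sum hz
          (Finset.mem_erase.2 ⟨hne, Finset.mem_univ (i, j0)⟩))
        rw [hpne _ _ hne, htg, her']
      nlinarith

variable (i0 : Fin ℓ) (y0 : Fin m)

/-- Distance of the rear-most mutant (beyond the first path vertex) from the path's end. -/
def rk (S : Finset (SuperstarV k ℓ m)) : ℕ :=
  (Finset.univ.filter fun j : Fin k => 0 < (j : ℕ) ∧ pv i0 j ∈ S).sup fun j => k - (j : ℕ)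

/-- The cost of the mutants on the path and the centre. -/
noncomputable def psi (hk : 0 < k) (u q s : ℝ) (S : Finset (SuperstarV k ℓ m)) : ℝ :=
  u * (if pv i0 ⟨0, hk⟩ ∈ S then 1 else 0) + q * (rk i0 S : ℝ) + s * (if cv ∈ S then 1 else 0)

/-- The only reservoir mutant is the initial one, and no other path has mutants. -/
def Live (S : Finset (SuperstarV k ℓ m)) : Prop :=
  rv (i0, y0) ∈ S ∧ (∀ p, rv p ∈ S → p = (i0, y0)) ∧ ∀ i j, pv i j ∈ S → i = i0

open Classical in
/-- The potential function. -/
noncomputable def pot (hk : 0 < k) (u q s a : ℝ) (S : Finset (SuperstarV k ℓ m)) : ℝ :=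
  if S = ∅ then 1 else if Live i0 y0 S then a * max 0 (1 - psi i0 hk u q s S) else 0

variable {i0 y0} {S S' : Finset (SuperstarV k ℓ m)}

lemma rk_mono (h : S ⊆ S') : rk i0 S ≤ rk i0 S' := by
  unfold rk
  apply Finset.sup_mono
  intro j
  simp only [Finset.mem_filter, Finset.mem_univ, true_and]
  exact fun hj => ⟨hj.1, h hj.2⟩

lemma le_rk {j : Fin k} (hj : 0 < (j : ℕ)) (h : pv i0 j ∈ S) : k - (j : ℕ) ≤ rk i0 S := by
  unfold rk
  exact Finset.le_sup (f := fun j : Fin k => k - (j : ℕ)) (by simp [hj, h])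

lemma rk_le_of {b : ℕ} (h : ∀ j : Fin k, 0 < (j : ℕ) → pv i0 j ∈ S → k - (j : ℕ) ≤ b) :
    rk i0 S ≤ b := by
  unfold rk
  apply Finset.sup_le
  intro j hj
  simp only [Finset.mem_filter, Finset.mem_univ, true_and] at hj
  exact h j hj.1 hj.2

lemma rk_le : rk i0 S ≤ k := rk_le_of fun _ _ _ => Nat.sub_le _ _

lemma psi_mono {hk : 0 < k} {u q s : ℝ} (hu : 0 ≤ u) (hq : 0 ≤ q) (hs : 0 ≤ s) (h : S ⊆ S') :
    psi i0 hk u q s S ≤ psi i0 hk u q s S' := by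
  unfold psi
  have h1 : (rk i0 S : ℝ) ≤ rk i0 S' := by exact_mod_cast rk_mono h
  have h2 : (if pv i0 ⟨0, hk⟩ ∈ S then (1 : ℝ) else 0) ≤ if pv i0 ⟨0, hk⟩ ∈ S' then 1 else 0 := by
    by_cases h' : pv i0 ⟨0, hk⟩ ∈ S
    · rw [if_pos h', if_pos (h h')]
    · rw [if_neg h']; split_ifs <;> norm_num
  have h3 : (if cv ∈ S then (1 : ℝ) else 0) ≤ if cv ∈ S' then 1 else 0 := by
    by_cases h' : cv ∈ S
    · rw [if_pos h', if_pos (h h')]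
    · rw [if_neg h']; split_ifs <;> norm_num
  gcongr

lemma psi_nonneg {hk : 0 < k} {u q s : ℝ} (hu : 0 ≤ u) (hq : 0 ≤ q) (hs : 0 ≤ s) :
    0 ≤ psi i0 hk u q s S := by
  unfold psi
  split_ifs <;> positivity

lemma psi_insert_zero {hk : 0 < k} {u q s : ℝ} (hu : 0 ≤ u) :
    psi i0 hk u q s (insert (pv i0 ⟨0, hk⟩) S) ≤ psi i0 hk u q s S + u := by
  have h1 : rk i0 (insert (pv i0 ⟨0, hk⟩) S) = rk i0 S := by
    apply le_antisymm _ (rk_mono (Finset.subset_insert _ _))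
    refine rk_le_of fun j hj h => le_rk hj ?_
    rcases Finset.mem_insert.1 h with h | h
    · simp at h
      rw [h] at hj; simp at hj
    · exact h
  unfold psi
  rw [h1]
  simp
  split_ifs <;> linarith

lemma psi_insert_cv {hk : 0 < k} {u q s : ℝ} (hs : 0 ≤ s) :
    psi i0 hk u q s (insert cv S) ≤ psi i0 hk u q s S + s := by
  have h1 : rk i0 (insert cv S) = rk i0 S := by
    apply le_antisymm _ (rk_mono (Finset.subset_insert _ _))
    refine rk_le_of fun j hj h => le_rk hj ?_
    rcases Finset.mem_insert.1 h with h | h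
    · simp at h
    · exact h
  unfold psi
  rw [h1]
  simp
  split_ifs <;> linarith

lemma psi_insert_pos {hk : 0 < k} {u q s : ℝ} (hq : 0 ≤ q) {j : Fin k} (hj : 0 < (j : ℕ)) :
    psi i0 hk u q s (insert (pv i0 j) S) ≤ psi i0 hk u q s S + q * k := by
  have h1 : (rk i0 (insert (pv i0 j) S) : ℝ) ≤ k := by exact_mod_cast rk_le
  have h2 : (0 : ℝ) ≤ rk i0 S := Nat.cast_nonneg _
  have h3 : (⟨0, hk⟩ : Fin k) ≠ j := by rintro rfl; simp at hj
  unfold psi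
  simp [h3]
  nlinarith

lemma psi_insert_next {hk : 0 < k} {u q s : ℝ} {j j' : Fin k} (hj : 0 < (j : ℕ))
    (hjj : (j : ℕ) ≤ j') (h : pv i0 j ∈ S) :
    psi i0 hk u q s (insert (pv i0 j') S) = psi i0 hk u q s S := by
  have h1 : rk i0 (insert (pv i0 j') S) = rk i0 S := by
    apply le_antisymm _ (rk_mono (Finset.subset_insert _ _))
    refine rk_le_of fun j'' hj'' h'' => ?_
    rcases Finset.mem_insert.1 h'' with h' | h'
    · simp at h'
      have := le_rk hj h
      rw [h']; omega
    · exact le_rk hj'' h'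
  have h3 : (⟨0, hk⟩ : Fin k) ≠ j' := by rintro rfl; simp at hjj; omega
  unfold psi
  rw [h1]
  simp [h3]

lemma psi_erase_zero {hk : 0 < k} {u q s : ℝ} (hq : 0 ≤ q)
    (h : pv i0 ⟨0, hk⟩ ∈ S) :
    psi i0 hk u q s (S.erase (pv i0 ⟨0, hk⟩)) ≤ psi i0 hk u q s S - u := by
  have h1 : (rk i0 (S.erase (pv i0 ⟨0, hk⟩)) : ℝ) ≤ rk i0 S := by
    exact_mod_cast rk_mono (Finset.erase_subset _ _)
  unfold psi
  simp [h]
  nlinarith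

lemma psi_erase_cv {hk : 0 < k} {u q s : ℝ} (hq : 0 ≤ q) (h : cv ∈ S) :
    psi i0 hk u q s (S.erase cv) ≤ psi i0 hk u q s S - s := by
  have h1 : (rk i0 (S.erase cv) : ℝ) ≤ rk i0 S := by
    exact_mod_cast rk_mono (Finset.erase_subset _ _)
  unfold psi
  simp [h]
  nlinarith

lemma psi_erase_rear {hk : 0 < k} {u q s : ℝ} (hq : 0 ≤ q) {j : Fin k} (hj : 0 < (j : ℕ))
    (h : pv i0 j ∈ S) (hmin : ∀ j' : Fin k, 0 < (j' : ℕ) → pv i0 j' ∈ S → j ≤ j') :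
    psi i0 hk u q s (S.erase (pv i0 j)) ≤ psi i0 hk u q s S - q := by
  have h1 : rk i0 (S.erase (pv i0 j)) + 1 ≤ rk i0 S := by
    have h2 := le_rk hj h
    have h3 : rk i0 (S.erase (pv i0 j)) ≤ k - (j : ℕ) - 1 := by
      refine rk_le_of fun j' hj' h' => ?_
      have h4 := hmin j' hj' (Finset.mem_of_mem_erase h')
      have h5 : j' ≠ j := by rintro rfl; simp at h'
      have h6 : (j : ℕ) < j' := lt_of_le_of_ne h4 (fun h => h5 (Fin.ext h.symm))
      omega
    have := j.2
    omega
  have h1' : (rk i0 (S.erase (pv i0 j)) : ℝ) + 1 ≤ rk i0 S := by exact_mod_cast h1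
  have h3 : (⟨0, hk⟩ : Fin k) ≠ j := by rintro rfl; simp at hj
  unfold psi
  simp [h3]
  nlinarith

lemma Live.erase (h : Live i0 y0 S) {v : SuperstarV k ℓ m} (hv : v ≠ rv (i0, y0)) :
    Live i0 y0 (S.erase v) :=
  ⟨Finset.mem_erase.2 ⟨hv.symm, h.1⟩, fun p hp => h.2.1 p (Finset.mem_of_mem_erase hp),
    fun i j hp => h.2.2 i j (Finset.mem_of_mem_erase hp)⟩

lemma Live.insert_pv (h : Live i0 y0 S) (j : Fin k) : Live i0 y0 (insert (pv i0 j) S) := by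
  refine ⟨Finset.mem_insert_of_mem h.1, fun p hp => ?_, fun i j' hp => ?_⟩
  · rcases Finset.mem_insert.1 hp with h' | h'
    · simp at h'
    · exact h.2.1 p h'
  · rcases Finset.mem_insert.1 hp with h' | h'
    · simp at h'; exact h'.1
    · exact h.2.2 i j' h'

lemma Live.insert_cv (h : Live i0 y0 S) : Live i0 y0 (insert cv S) := by
  refine ⟨Finset.mem_insert_of_mem h.1, fun p hp => ?_, fun i j' hp => ?_⟩
  · rcases Finset.mem_insert.1 hp with h' | h'
    · simp at h'
    · exact h.2.1 p h'
  · rcases Finset.mem_insert.1 hp with h' | h'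
    · simp at h'
    · exact h.2.2 i j' h'

lemma pot_live {hk : 0 < k} {u q s a : ℝ} (h : Live i0 y0 S) :
    pot i0 y0 hk u q s a S = a * max 0 (1 - psi i0 hk u q s S) := by
  have : S ≠ ∅ := by rintro rfl; simp [Live] at h
  simp [pot, this, h]

lemma pot_nonneg {hk : 0 < k} {u q s a : ℝ} (ha : 0 ≤ a) : 0 ≤ pot i0 y0 hk u q s a S := by
  unfold pot
  split_ifs
  · norm_num
  · positivity
  · exact le_rfl

lemma pot_le {hk : 0 < k} {u q s a : ℝ} (hu : 0 ≤ u) (hq : 0 ≤ q) (hs : 0 ≤ s) (ha : 0 ≤ a)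
    (h : Live i0 y0 S) : pot i0 y0 hk u q s a S ≤ a := by
  rw [pot_live h]
  have := psi_nonneg (i0 := i0) (S := S) (hk := hk) hu hq hs
  have : max 0 (1 - psi i0 hk u q s S) ≤ 1 := max_le (by norm_num) (by linarith)
  nlinarith

lemma pot_le_one {hk : 0 < k} {u q s a : ℝ} (hu : 0 ≤ u) (hq : 0 ≤ q) (hs : 0 ≤ s) (ha : 0 ≤ a)
    (ha1 : a ≤ 1) : pot i0 y0 hk u q s a S ≤ 1 := by
  by_cases h : Live i0 y0 S
  · exact (pot_le hu hq hs ha h).trans ha1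
  · unfold pot
    split_ifs <;> norm_num

lemma pot_gain {hk : 0 < k} {u q s a d : ℝ} (ha : 0 ≤ a) (h : Live i0 y0 S)
    (h1 : psi i0 hk u q s S ≤ 1) (h' : Live i0 y0 S')
    (hd : psi i0 hk u q s S' ≤ psi i0 hk u q s S - d) :
    a * d ≤ pot i0 y0 hk u q s a S' - pot i0 y0 hk u q s a S := by
  rw [pot_live h, pot_live h', max_eq_right (b := 1 - psi i0 hk u q s S) (by linarith), ← mul_sub]
  apply mul_le_mul_of_nonneg_left _ ha
  have := le_max_right 0 (1 - psi i0 hk u q s S')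
  linarith

lemma pot_loss {hk : 0 < k} {u q s a d : ℝ} (hu : 0 ≤ u) (hq : 0 ≤ q) (hs : 0 ≤ s)
    (ha : 0 ≤ a) (h : Live i0 y0 S)
    (h1 : psi i0 hk u q s S ≤ 1) (h' : Live i0 y0 S')
    (hd : psi i0 hk u q s S' ≤ psi i0 hk u q s S + d) :
    -(a * min 1 d) ≤ pot i0 y0 hk u q s a S' - pot i0 y0 hk u q s a S := by
  rcases le_total 1 d with h2 | h2
  · rw [min_eq_left h2]
    have := pot_le (hk := hk) hu hq hs ha h
    have := pot_nonneg (i0 := i0) (y0 := y0) (S := S') (hk := hk) (u := u) (q := q) (s := s) ha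
    linarith
  · rw [min_eq_right h2, ← mul_neg]
    exact pot_gain ha h h1 h' (by linarith)

lemma Live.pv_notMem (h : Live i0 y0 S) {i : Fin ℓ} (hi : i ≠ i0) (j : Fin k) : pv i j ∉ S :=
  fun h' => hi (h.2.2 i j h')

lemma Live.rv_notMem (h : Live i0 y0 S) {p : Fin ℓ × Fin m} (hp : p ≠ (i0, y0)) : rv p ∉ S :=
  fun h' => hp (h.2.1 p h')

lemma pot_erase {hk : 0 < k} {u q s a : ℝ} (hu : 0 ≤ u) (hq : 0 ≤ q) (hs : 0 ≤ s)
    (ha : 0 ≤ a) (h : Live i0 y0 S)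
    (h1 : psi i0 hk u q s S ≤ 1) {v : SuperstarV k ℓ m} (hv : v ≠ rv (i0, y0)) :
    0 ≤ pot i0 y0 hk u q s a (S.erase v) - pot i0 y0 hk u q s a S := by
  have := pot_gain (hk := hk) (d := 0) ha h h1 (h.erase hv)
    (by have := psi_mono (i0 := i0) (hk := hk) hu hq hs (Finset.erase_subset v S); linarith)
  linarith

section core
variable {hk : 0 < k} {u q s a r : ℝ}

lemma res_bound (hu : 0 ≤ u) (hq : 0 ≤ q) (hs : 0 ≤ s) (ha : 0 ≤ a) (hr : 1 < r)
    (h : Live i0 y0 S) (h1 : psi i0 hk u q s S ≤ 1) :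
    a * (((m : ℝ) - 1) * u * (if pv i0 ⟨0, hk⟩ ∈ S then 1 else 0) - r * u) ≤
      ∑ p : Fin ℓ × Fin m, (if rv p ∈ S then r else 1)
        * (pot i0 y0 hk u q s a (mNext S (rv p) (pv p.1 ⟨0, hk⟩)) - pot i0 y0 hk u q s a S) := by
  set α : ℝ := if pv i0 ⟨0, hk⟩ ∈ S then 1 else 0 with hα
  have hα0 : 0 ≤ α := by rw [hα]; split_ifs <;> norm_num
  have key : ∀ p : Fin ℓ × Fin m,
      (if p.1 = i0 then a * (u * α) else 0)
        - (if p = (i0, y0) then a * (u * α) + r * (a * u) else 0) ≤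
      (if rv p ∈ S then r else 1)
        * (pot i0 y0 hk u q s a (mNext S (rv p) (pv p.1 ⟨0, hk⟩)) - pot i0 y0 hk u q s a S) := by
    intro p
    by_cases hp : p = (i0, y0)
    · subst hp
      rw [if_pos rfl, if_pos rfl, if_pos h.1]
      unfold mNext
      rw [if_pos h.1]
      have := pot_loss (hk := hk) hu hq hs ha h h1 (h.insert_pv ⟨0, hk⟩) (psi_insert_zero hu)
      have h2 : a * min 1 u ≤ a * u := mul_le_mul_of_nonneg_left (min_le_right _ _) ha
      nlinarith
    · rw [if_neg hp, if_neg (h.rv_notMem hp)]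
      unfold mNext
      rw [if_neg (h.rv_notMem hp)]
      by_cases hi : p.1 = i0
      · rw [if_pos hi, hi]
        by_cases hz : pv i0 ⟨0, hk⟩ ∈ S
        · have := pot_gain (hk := hk) ha h h1 (h.erase (v := pv i0 ⟨0, hk⟩) (by simp))
            (psi_erase_zero hq hz)
          rw [hα, if_pos hz]
          linarith
        · rw [hα, if_neg hz, Finset.erase_eq_of_notMem hz]
          simp
      · rw [if_neg hi, Finset.erase_eq_of_notMem (h.pv_notMem hi _)]
        simp
  refine le_trans (le_of_eq ?_) (Finset.sum_le_sum fun p _ => key p)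
  rw [Finset.sum_sub_distrib, Fintype.sum_prod_type_right]
  simp
  ring

lemma other_path_bound (hu : 0 ≤ u) (hq : 0 ≤ q) (hs : 0 ≤ s) (ha : 0 ≤ a)
    (h : Live i0 y0 S) (h1 : psi i0 hk u q s S ≤ 1) {i : Fin ℓ} (hi : i ≠ i0) :
    a * (s * (if cv ∈ S then 1 else 0)) ≤ ∑ j : Fin k, (if pv i j ∈ S then r else 1)
        * (pot i0 y0 hk u q s a (mNext S (pv i j) (ptgt i j)) - pot i0 y0 hk u q s a S) := by
  have hterm : ∀ j : Fin k, (if pv i j ∈ S then r else 1)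
        * (pot i0 y0 hk u q s a (mNext S (pv i j) (ptgt i j)) - pot i0 y0 hk u q s a S)
      = pot i0 y0 hk u q s a (S.erase (ptgt i j)) - pot i0 y0 hk u q s a S := by
    intro j
    unfold mNext
    rw [if_neg (h.pv_notMem hi j), if_neg (h.pv_notMem hi j), one_mul]
  simp only [hterm]
  have hnn : ∀ j : Fin k,
      0 ≤ pot i0 y0 hk u q s a (S.erase (ptgt i j)) - pot i0 y0 hk u q s a S := by
    intro j
    apply pot_erase hu hq hs ha h h1
    unfold ptgt
    split_ifs <;> simp
  refine le_trans ?_ (Finset.single_le_sum (fun j _ => hnn j)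
    (Finset.mem_univ (⟨k - 1, by omega⟩ : Fin k)))
  have ht : (ptgt i (⟨k - 1, by omega⟩ : Fin k) : SuperstarV k ℓ m) = cv := by
    unfold ptgt
    rw [dif_neg]
    simp; omega
  rw [ht]
  by_cases hc : cv ∈ S
  · have := pot_gain (hk := hk) ha h h1 (h.erase (v := cv) (by simp)) (psi_erase_cv hq hc)
    rw [if_pos hc]; linarith
  · rw [if_neg hc, Finset.erase_eq_of_notMem hc]; simp

lemma term_last (hu : 0 ≤ u) (hq : 0 ≤ q) (hs : 0 ≤ s) (ha : 0 ≤ a) (hr : 1 < r)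
    (h : Live i0 y0 S) (h1 : psi i0 hk u q s S ≤ 1) (j : Fin k) (hj : ¬ (j : ℕ) + 1 < k) :
    -(r * (a * min 1 s)) ≤ (if pv i0 j ∈ S then r else 1)
        * (pot i0 y0 hk u q s a (mNext S (pv i0 j) (ptgt i0 j)) - pot i0 y0 hk u q s a S) := by
  have ht : (ptgt i0 j : SuperstarV k ℓ m) = cv := by
    unfold ptgt
    rw [dif_neg hj]
  have hmin : 0 ≤ min 1 s := le_min zero_le_one hs
  have : 0 ≤ r * (a * min 1 s) := by positivity
  unfold mNext
  rw [ht]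
  split_ifs with hS
  · have := pot_loss (hk := hk) hu hq hs ha h h1 h.insert_cv (psi_insert_cv hs)
    nlinarith
  · have := pot_erase (hk := hk) hu hq hs ha h h1 (v := cv) (by simp)
    linarith

lemma term_mid (hu : 0 ≤ u) (hq : 0 ≤ q) (hs : 0 ≤ s) (ha : 0 ≤ a)
    (h : Live i0 y0 S) (h1 : psi i0 hk u q s S ≤ 1) (j : Fin k) (hj : (j : ℕ) + 1 < k)
    (hj0 : 0 < (j : ℕ) ∨ pv i0 j ∉ S) :
    0 ≤ (if pv i0 j ∈ S then r else 1)
        * (pot i0 y0 hk u q s a (mNext S (pv i0 j) (ptgt i0 j)) - pot i0 y0 hk u q s a S) := by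
  have ht : (ptgt i0 j : SuperstarV k ℓ m) = pv i0 ⟨(j : ℕ) + 1, hj⟩ := by
    unfold ptgt
    rw [dif_pos hj]
  unfold mNext
  rw [ht]
  split_ifs with hS
  · have hj1 : 0 < (j : ℕ) := by
      rcases hj0 with h' | h'
      · exact h'
      · exact absurd hS h'
    rw [pot_live h, pot_live (h.insert_pv _), psi_insert_next hj1 (by simp) hS]
    simp
  · have := pot_erase (hk := hk) hu hq hs ha h h1 (v := pv i0 ⟨(j : ℕ) + 1, hj⟩) (by simp)
    linarith

lemma path_bound1 (hu : 0 ≤ u) (hq : 0 ≤ q) (hs : 0 ≤ s) (ha : 0 ≤ a) (hr : 1 < r)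
    (h : Live i0 y0 S) (h1 : psi i0 hk u q s S ≤ 1) :
    -(r * (a * min 1 (q * k))) - r * (a * min 1 s) ≤ ∑ j : Fin k, (if pv i0 j ∈ S then r else 1)
        * (pot i0 y0 hk u q s a (mNext S (pv i0 j) (ptgt i0 j)) - pot i0 y0 hk u q s a S) := by
  have hm1 : 0 ≤ min 1 (q * k) := le_min zero_le_one (by positivity)
  have hm2 : 0 ≤ min 1 s := le_min zero_le_one hs
  have hp1 : 0 ≤ r * (a * min 1 (q * k)) := by positivity
  have hp2 : 0 ≤ r * (a * min 1 s) := by positivity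
  have key : ∀ j : Fin k, (if j = ⟨0, hk⟩ then -(r * (a * min 1 (q * k))) else 0)
      - (if j = ⟨k - 1, by omega⟩ then r * (a * min 1 s) else 0) ≤
      (if pv i0 j ∈ S then r else 1)
        * (pot i0 y0 hk u q s a (mNext S (pv i0 j) (ptgt i0 j)) - pot i0 y0 hk u q s a S) := by
    intro j
    by_cases hj : (j : ℕ) + 1 < k
    · have hne : j ≠ ⟨k - 1, by omega⟩ := by
        intro hh
        have hh' := congrArg Fin.val hh
        simp at hh'
        omega
      rw [if_neg hne]
      by_cases hj0 : 0 < (j : ℕ) ∨ pv i0 j ∉ S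
      · refine le_trans ?_ (term_mid hu hq hs ha h h1 j hj hj0)
        split_ifs <;> linarith
      · push Not at hj0
        have hjz : j = ⟨0, hk⟩ := Fin.ext (by simp; omega)
        rw [if_pos hjz, if_pos hj0.2]
        unfold mNext ptgt
        rw [if_pos hj0.2, dif_pos hj]
        have := pot_loss (hk := hk) hu hq hs ha h h1 (h.insert_pv ⟨(j : ℕ) + 1, hj⟩)
          (psi_insert_pos hq (by simp))
        nlinarith
    · have hjl : j = ⟨k - 1, by omega⟩ := Fin.ext (by simp; omega)
      refine le_trans ?_ (term_last hu hq hs ha hr h h1 j hj)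
      rw [if_pos hjl]
      split_ifs <;> linarith
  refine le_trans (le_of_eq ?_) (Finset.sum_le_sum fun j _ => key j)
  rw [Finset.sum_sub_distrib]
  simp

lemma path_bound2 (hu : 0 ≤ u) (hq : 0 ≤ q) (hs : 0 ≤ s) (ha : 0 ≤ a)
    (h : Live i0 y0 S) (h1 : psi i0 hk u q s S ≤ 1) (hno : ∀ j : Fin k, pv i0 j ∉ S) :
    0 ≤ ∑ j : Fin k, (if pv i0 j ∈ S then r else 1)
        * (pot i0 y0 hk u q s a (mNext S (pv i0 j) (ptgt i0 j)) - pot i0 y0 hk u q s a S) := by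
  refine Finset.sum_nonneg fun j _ => ?_
  unfold mNext
  rw [if_neg (hno j), if_neg (hno j), one_mul]
  apply pot_erase hu hq hs ha h h1
  unfold ptgt
  split_ifs <;> simp

lemma path_bound3 (hu : 0 ≤ u) (hq : 0 ≤ q) (hs : 0 ≤ s) (ha : 0 ≤ a) (hr : 1 < r)
    (h : Live i0 y0 S) (h1 : psi i0 hk u q s S ≤ 1) (hz : pv i0 ⟨0, hk⟩ ∉ S)
    (hex : ∃ j : Fin k, pv i0 j ∈ S) :
    a * q - r * (a * min 1 s) ≤ ∑ j : Fin k, (if pv i0 j ∈ S then r else 1)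
        * (pot i0 y0 hk u q s a (mNext S (pv i0 j) (ptgt i0 j)) - pot i0 y0 hk u q s a S) := by
  have hm2 : 0 ≤ min 1 s := le_min zero_le_one hs
  have hp2 : 0 ≤ r * (a * min 1 s) := by positivity
  obtain ⟨j1, hj1, hmin⟩ : ∃ j1 : Fin k, pv i0 j1 ∈ S ∧ ∀ j, pv i0 j ∈ S → j1 ≤ j := by
    obtain ⟨j1, hj1, hmin⟩ := Finset.exists_min_image
      (Finset.univ.filter fun j : Fin k => pv i0 j ∈ S) id
      (by obtain ⟨j, hj⟩ := hex; exact ⟨j, by simpa using hj⟩)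
    refine ⟨j1, by simpa using hj1, fun j hj => hmin j (by simpa using hj)⟩
  have hpos : 0 < (j1 : ℕ) := by
    rcases Nat.eq_zero_or_pos (j1 : ℕ) with h0 | h0
    · exact absurd ((Fin.ext h0 : j1 = ⟨0, hk⟩) ▸ hj1) hz
    · exact h0
  obtain ⟨j0, hj0⟩ : ∃ j0 : Fin k, (j0 : ℕ) + 1 = j1 :=
    ⟨⟨j1 - 1, by omega⟩, by simp; omega⟩
  have hj0S : pv i0 j0 ∉ S := fun hh => by
    have : (j1 : ℕ) ≤ j0 := hmin j0 hh
    omega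
  have htg : (ptgt i0 j0 : SuperstarV k ℓ m) = pv i0 j1 := by
    unfold ptgt
    rw [dif_pos (by omega)]
    congr
  have key : ∀ j : Fin k, (if j = j0 then a * q else 0)
      - (if j = ⟨k - 1, by omega⟩ then r * (a * min 1 s) else 0) ≤
      (if pv i0 j ∈ S then r else 1)
        * (pot i0 y0 hk u q s a (mNext S (pv i0 j) (ptgt i0 j)) - pot i0 y0 hk u q s a S) := by
    intro j
    by_cases hjj : j = j0
    · subst hjj
      have hg := pot_gain (hk := hk) ha h h1 (h.erase (v := pv i0 j1) (by simp))
        (psi_erase_rear hq hpos hj1 fun j' _ hj' => hmin j' hj')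
      unfold mNext
      rw [if_neg hj0S, if_neg hj0S, htg, if_pos rfl]
      split_ifs <;> linarith
    · rw [if_neg hjj]
      by_cases hj : (j : ℕ) + 1 < k
      · refine le_trans ?_ (term_mid hu hq hs ha h h1 j hj ?_)
        · split_ifs <;> linarith
        · by_cases hjS : pv i0 j ∈ S
          · left
            have : (j1 : ℕ) ≤ j := hmin j hjS
            omega
          · exact Or.inr hjS
      · have hjl : j = ⟨k - 1, by omega⟩ := Fin.ext (by simp; omega)
        refine le_trans ?_ (term_last hu hq hs ha hr h h1 j hj)
        rw [if_pos hjl]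
        linarith
  refine le_trans (le_of_eq ?_) (Finset.sum_le_sum fun j _ => key j)
  rw [Finset.sum_sub_distrib]
  simp

lemma centre_in (hl : 0 < ℓ) (hm : 0 < m) (hu : 0 ≤ u) (hq : 0 ≤ q) (hs : 0 ≤ s) (ha : 0 ≤ a)
    (hr : 1 < r) (h : Live i0 y0 S) :
    -(r * a) ≤ r * (((ℓ : ℝ) * m)⁻¹ *
      ∑ p : Fin ℓ × Fin m, (pot i0 y0 hk u q s a (mNext S cv (rv p)) - pot i0 y0 hk u q s a S)) := by
  have h2 : ∀ p : Fin ℓ × Fin m,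
      -a ≤ pot i0 y0 hk u q s a (mNext S cv (rv p)) - pot i0 y0 hk u q s a S := by
    intro p
    have := pot_le (hk := hk) hu hq hs ha h
    have := pot_nonneg (i0 := i0) (y0 := y0) (S := mNext S cv (rv p)) (hk := hk)
      (u := u) (q := q) (s := s) ha
    linarith
  have h3 := Finset.sum_le_sum fun p (_ : p ∈ (Finset.univ : Finset (Fin ℓ × Fin m))) => h2 p
  simp only [Finset.sum_const, Finset.card_univ, Fintype.card_prod, Fintype.card_fin,
    nsmul_eq_mul] at h3
  push_cast at h3
  have hl' : (0 : ℝ) < ℓ := by exact_mod_cast hl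
  have hm' : (0 : ℝ) < m := by exact_mod_cast hm
  have h4 := mul_le_mul_of_nonneg_left h3 (show 0 ≤ ((ℓ : ℝ) * m)⁻¹ by positivity)
  have h5 : ((ℓ : ℝ) * m)⁻¹ * (ℓ * m * -a) = -a := by field_simp
  rw [h5] at h4
  nlinarith

lemma centre_out (hu : 0 ≤ u) (hq : 0 ≤ q) (hs : 0 ≤ s) (ha : 0 ≤ a)
    (h : Live i0 y0 S) (hc : cv ∉ S) :
    ((ℓ : ℝ) * m)⁻¹ * (if S = {rv (i0, y0)} then 1 - a else -a) ≤ ((ℓ : ℝ) * m)⁻¹ *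
      ∑ p : Fin ℓ × Fin m, (pot i0 y0 hk u q s a (mNext S cv (rv p)) - pot i0 y0 hk u q s a S) := by
  apply mul_le_mul_of_nonneg_left _ (by positivity)
  have := pot_le (hk := hk) hu hq hs ha h
  rw [Finset.sum_eq_single (i0, y0)]
  · unfold mNext
    rw [if_neg hc]
    split_ifs with hS
    · subst hS
      have : pot i0 y0 hk u q s a (({rv (i0, y0)} : Finset (SuperstarV k ℓ m)).erase
        (rv (i0, y0))) = 1 := by simp [pot]
      linarith
    · have := pot_nonneg (i0 := i0) (y0 := y0) (S := S.erase (rv (i0, y0))) (hk := hk)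
        (u := u) (q := q) (s := s) ha
      linarith
  · intro p _ hp
    unfold mNext
    rw [if_neg hc, Finset.erase_eq_of_notMem (h.rv_notMem hp)]
    simp
  · simp

/-- The core estimate: a single reservoir mutant dies out with probability at least `a`. -/
lemma res_ext (hk : 0 < k) (hl : 0 < ℓ) (hm : 0 < m) (hu : 0 ≤ u) (hq : 0 ≤ q) (hs : 0 ≤ s)
    (ha : 0 < a) (ha1 : a ≤ 1) (hr : 1 < r) (i0 : Fin ℓ) (y0 : Fin m)
    (H0 : a * (r * u) < ((ℓ : ℝ) * m)⁻¹ * (1 - a))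
    (H1 : r * min 1 (q * k) + r * min 1 s + (((ℓ : ℝ) * m)⁻¹ + r * u) < ((m : ℝ) - 1) * u)
    (H2 : r * min 1 s + (((ℓ : ℝ) * m)⁻¹ + r * u) < q)
    (H3 : s < 1 → r + (((ℓ : ℝ) * m)⁻¹ + r * u) < ((ℓ : ℝ) - 1) * s) :
    a ≤ extinctionProb r (outWeights (superstarOut k ℓ m)) (pointInit (rv (i0, y0))) := by
  have : Nonempty (SuperstarV k ℓ m) := ⟨cv⟩
  have hlive : Live i0 y0 ({rv (i0, y0)} : Finset (SuperstarV k ℓ m)) := by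
    refine ⟨by simp, fun p hp => by simpa using hp, fun i j hp => by simp at hp⟩
  have hrk : rk i0 ({rv (i0, y0)} : Finset (SuperstarV k ℓ m)) = 0 := by
    have := rk_le_of (i0 := i0) (S := ({rv (i0, y0)} : Finset (SuperstarV k ℓ m))) (b := 0)
      (fun j _ h => by simp at h)
    omega
  have hstart : pot i0 y0 hk u q s a {rv (i0, y0)} = a := by
    rw [pot_live hlive]
    simp [psi, hrk]
  rw [← hstart]
  refine point_ext_ge (by linarith) ow_nonneg (ow_one hk hl hm) _ _
    (fun S => pot_nonneg ha.le) (fun S => pot_le_one hu hq hs ha.le ha1) ?_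
  intro S hS hpos
  have h : Live i0 y0 S := by
    by_contra hn
    simp [pot, hS, hn] at hpos
  have hlt : psi i0 hk u q s S < 1 := by
    rw [pot_live h] at hpos
    by_contra hn
    rw [max_eq_left (by linarith)] at hpos
    simp at hpos
  have h1 := hlt.le
  rw [drift_formula hk]
  have hR := res_bound (hk := hk) hu hq hs ha.le hr h h1
  have hP : ((ℓ : ℝ) - 1) * (a * (s * (if cv ∈ S then 1 else 0))) +
      (∑ j : Fin k, (if pv i0 j ∈ S then r else 1)
        * (pot i0 y0 hk u q s a (mNext S (pv i0 j) (ptgt i0 j)) - pot i0 y0 hk u q s a S)) ≤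
      ∑ i : Fin ℓ, ∑ j : Fin k, (if pv i j ∈ S then r else 1)
        * (pot i0 y0 hk u q s a (mNext S (pv i j) (ptgt i j)) - pot i0 y0 hk u q s a S) := by
    rw [← Finset.sum_erase_add _ _ (Finset.mem_univ i0)]
    apply add_le_add_left
    have := Finset.sum_le_sum fun i (hi : i ∈ Finset.univ.erase i0) =>
      other_path_bound (r := r) (hk := hk) hu hq hs ha.le h h1 (Finset.ne_of_mem_erase hi)
    refine le_trans (le_of_eq ?_) this
    rw [Finset.sum_const, Finset.card_erase_of_mem (Finset.mem_univ _)]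
    simp only [Finset.card_univ, Fintype.card_fin, nsmul_eq_mul]
    rw [Nat.cast_sub hl]; simp
  have hru : 0 ≤ r * u := by nlinarith
  have hinv : 0 ≤ ((ℓ : ℝ) * m)⁻¹ := by positivity
  have hm2 : 0 ≤ min 1 s := le_min zero_le_one hs
  have hm1 : 0 ≤ min 1 (q * k) := le_min zero_le_one (by positivity)
  have hr0 : 0 < r := by linarith
  have harm2 : 0 ≤ r * min 1 s := by positivity
  have hs1 : cv ∈ S → s < 1 := by
    intro hc
    refine lt_of_le_of_lt ?_ hlt
    unfold psi
    rw [if_pos hc]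
    have : 0 ≤ u * (if pv i0 ⟨0, hk⟩ ∈ S then 1 else 0) := by split_ifs <;> simp [hu]
    have : 0 ≤ q * (rk i0 S : ℝ) := by positivity
    linarith
  by_cases hSx : S = {rv (i0, y0)}
  · have hc : cv ∉ S := by rw [hSx]; simp
    have hno : ∀ j : Fin k, pv i0 j ∉ S := by rw [hSx]; simp
    have hP2 := path_bound2 (r := r) (hk := hk) hu hq hs ha.le h h1 hno
    have hC := centre_out (hk := hk) hu hq hs ha.le h hc
    rw [if_pos hSx] at hC
    rw [if_neg hc] at hP ⊢
    rw [if_neg (hno _)] at hR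
    linarith
  · by_cases hz : pv i0 ⟨0, hk⟩ ∈ S
    · have hP1 := path_bound1 (hk := hk) hu hq hs ha.le hr h h1
      have H1' := mul_lt_mul_of_pos_left H1 ha
      rw [if_pos hz] at hR
      by_cases hc : cv ∈ S
      · have hC := centre_in (hk := hk) hl hm hu hq hs ha.le hr h
        have H3' := mul_lt_mul_of_pos_left (H3 (hs1 hc)) ha
        rw [if_pos hc] at hP ⊢
        have : 0 ≤ a * (((ℓ : ℝ) * m)⁻¹ + r * u) := by positivity
        have : 0 ≤ a * ((ℓ : ℝ) * m)⁻¹ := by positivity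
        linarith
      · have hC := centre_out (hk := hk) hu hq hs ha.le h hc
        rw [if_neg hSx] at hC
        rw [if_neg hc] at hP ⊢
        linarith
    · rw [if_neg hz] at hR
      by_cases hex : ∃ j : Fin k, pv i0 j ∈ S
      · have hP3 := path_bound3 (hk := hk) hu hq hs ha.le hr h h1 hz hex
        have H2' := mul_lt_mul_of_pos_left H2 ha
        by_cases hc : cv ∈ S
        · have hC := centre_in (hk := hk) hl hm hu hq hs ha.le hr h
          have H3' := mul_lt_mul_of_pos_left (H3 (hs1 hc)) ha
          rw [if_pos hc] at hP ⊢
          have : 0 ≤ a * (((ℓ : ℝ) * m)⁻¹ + r * u) := by positivity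
          have : 0 ≤ a * ((ℓ : ℝ) * m)⁻¹ := by positivity
          linarith
        · have hC := centre_out (hk := hk) hu hq hs ha.le h hc
          rw [if_neg hSx] at hC
          rw [if_neg hc] at hP ⊢
          linarith
      · push Not at hex
        have hP2 := path_bound2 (r := r) (hk := hk) hu hq hs ha.le h h1 hex
        have hc : cv ∈ S := by
          by_contra hc
          apply hSx
          ext v
          rw [Finset.mem_singleton]
          constructor
          · intro hv
            rcases v with p | ⟨i, j⟩ | ⟨⟩
            · rw [h.2.1 p hv]
            · have hi := h.2.2 i j hv
              subst hi
              exact absurd hv (hex j)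
            · exact absurd hv hc
          · rintro rfl
            exact h.1
        have hC := centre_in (hk := hk) hl hm hu hq hs ha.le hr h
        have H3' := mul_lt_mul_of_pos_left (H3 (hs1 hc)) ha
        rw [if_pos hc] at hP ⊢
        have : 0 ≤ a * ((ℓ : ℝ) * m)⁻¹ := by positivity
        linarith

end core

lemma boundA (hk : 0 < k) (hl : 0 < ℓ) (hm : 0 < m) {r : ℝ} (hr : 1 < r) :
    ((ℓ : ℝ) * (k + m) + 1)⁻¹ * (ℓ * k * (1 / (2 + r))) ≤
      extinctionProb r (outWeights (superstarOut k ℓ m)) (uniformSingleton _) ∧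
    ∀ b : ℝ, (∀ i y, b ≤ extinctionProb r (outWeights (superstarOut k ℓ m))
      (pointInit (rv (i, y)))) →
    ((ℓ : ℝ) * (k + m) + 1)⁻¹ * (ℓ * m * b) ≤
      extinctionProb r (outWeights (superstarOut k ℓ m)) (uniformSingleton _) := by
  have : Nonempty (SuperstarV k ℓ m) := ⟨cv⟩
  have hr0 : 0 < r := by linarith
  have hU := uniform_ext (V := SuperstarV k ℓ m) hr0 ow_nonneg (ow_one hk hl hm)
  have hcard : (Fintype.card (SuperstarV k ℓ m) : ℝ) = (ℓ : ℝ) * (k + m) + 1 := by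
    simp; ring
  rw [hcard, Fintype.sum_sum_type, Fintype.sum_sum_type] at hU
  have hnn : ∀ x : SuperstarV k ℓ m,
      0 ≤ extinctionProb r (outWeights (superstarOut k ℓ m)) (pointInit x) := by
    intro x
    apply Real.iSup_nonneg
    intro t
    exact dist_nonneg' hr0 ow_nonneg
      (by intro S; unfold pointInit; split_ifs <;> norm_num) _ _
  have hinv : 0 ≤ ((ℓ : ℝ) * (k + m) + 1)⁻¹ := by positivity
  have h1 : 0 ≤ ∑ x : Fin ℓ × Fin m,
      extinctionProb r (outWeights (superstarOut k ℓ m)) (pointInit (Sum.inl x)) :=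
    Finset.sum_nonneg fun x _ => hnn _
  have h2 : 0 ≤ ∑ x : Fin ℓ × Fin k,
      extinctionProb r (outWeights (superstarOut k ℓ m)) (pointInit (Sum.inr (Sum.inl x))) :=
    Finset.sum_nonneg fun x _ => hnn _
  have h3 : 0 ≤ ∑ x : Unit,
      extinctionProb r (outWeights (superstarOut k ℓ m)) (pointInit (Sum.inr (Sum.inr x))) :=
    Finset.sum_nonneg fun x _ => hnn _
  constructor
  · refine le_trans (mul_le_mul_of_nonneg_left ?_ hinv) hU
    have h4 := Finset.sum_le_sum fun (x : Fin ℓ × Fin k) (_ : x ∈ Finset.univ) =>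
      path_ext hk hl hm hr x.1 x.2
    simp only [Finset.sum_const, Finset.card_univ, Fintype.card_prod, Fintype.card_fin,
      nsmul_eq_mul, Prod.mk.eta] at h4
    push_cast at h4
    linarith
  · intro b hb
    refine le_trans (mul_le_mul_of_nonneg_left ?_ hinv) hU
    have h4 := Finset.sum_le_sum fun (x : Fin ℓ × Fin m) (_ : x ∈ Finset.univ) => hb x.1 x.2
    simp only [Finset.sum_const, Finset.card_univ, Fintype.card_prod, Fintype.card_fin,
      nsmul_eq_mul, Prod.mk.eta] at h4
    push_cast at h4
    linarith

lemma resB (hk : 0 < k) (hl : 0 < ℓ) (hm : 0 < m) {r : ℝ} (hr : 1 < r)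
    (hkm : 31 * r ^ 4 * k ≤ m) (i : Fin ℓ) (y : Fin m) :
    1 / (8 * r ^ 2 * ℓ) ≤
      extinctionProb r (outWeights (superstarOut k ℓ m)) (pointInit (rv (i, y))) := by
  have hl' : (1 : ℝ) ≤ ℓ := by exact_mod_cast hl
  have hk' : (1 : ℝ) ≤ k := by exact_mod_cast hk
  have hr2 : 1 < r ^ 2 := by nlinarith
  have hr4 : r ^ 2 ≤ r ^ 4 := by nlinarith [sq_nonneg (r ^ 2)]
  have hm31 : 31 * r ^ 2 ≤ (m : ℝ) := by nlinarith
  have hm' : (31 : ℝ) ≤ m := by linarith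
  have hm0 : (0 : ℝ) < m := by linarith
  have hl0 : (0 : ℝ) < ℓ := by linarith
  have hr0 : 0 < r := by linarith
  have hbeta : ((ℓ : ℝ) * m)⁻¹ + r * (6 * r / m) < 1 := by
    have h1 : ((ℓ : ℝ) * m)⁻¹ ≤ (m : ℝ)⁻¹ := inv_anti₀ hm0 (by nlinarith)
    have h2 : (m : ℝ)⁻¹ + r * (6 * r / m) = (1 + 6 * r ^ 2) / m := by field_simp
    have h3 : (1 + 6 * r ^ 2) / m < 1 := by rw [div_lt_one hm0]; nlinarith
    linarith
  have hmin1 : r * min 1 ((r + 1) * (k : ℝ)) ≤ r := by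
    have := min_le_left 1 ((r + 1) * (k : ℝ)); nlinarith
  have hmin2 : r * min 1 (1 : ℝ) ≤ r := by simp
  refine res_ext (u := 6 * r / m) (q := r + 1) (s := 1) hk hl hm (by positivity) (by positivity)
    (by norm_num) (by positivity) ?_ hr i y ?_ ?_ ?_ ?_
  · rw [div_le_one (by positivity)]; nlinarith
  · have h1 : 1 / (8 * r ^ 2 * ℓ) * (r * (6 * r / m)) = ((ℓ : ℝ) * m)⁻¹ * (3 / 4) := by
      field_simp; norm_num
    rw [h1]
    apply mul_lt_mul_of_pos_left _ (by positivity)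
    have : 1 / (8 * r ^ 2 * ℓ) < 1 / 4 := by
      apply one_div_lt_one_div_of_lt (by norm_num); nlinarith
    linarith
  · have h1 : 3 * r ≤ ((m : ℝ) - 1) * (6 * r / m) := by
      rw [mul_div_assoc', le_div_iff₀ hm0]; nlinarith
    linarith
  · linarith
  · intro h; exact absurd h (lt_irrefl _)

lemma resC (hk : 0 < k) (hl : 2 ≤ ℓ) (hm : 0 < m) {r : ℝ} (hr : 1 < r)
    (hkm : 31 * r ^ 4 * k ≤ m) (i : Fin ℓ) (y : Fin m) :
    1 / (32 * r ^ 4 * k) ≤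
      extinctionProb r (outWeights (superstarOut k ℓ m)) (pointInit (rv (i, y))) := by
  have hl' : (2 : ℝ) ≤ ℓ := by exact_mod_cast hl
  have hk' : (1 : ℝ) ≤ k := by exact_mod_cast hk
  have hr2 : 1 < r ^ 2 := by nlinarith
  have hr23 : r ^ 2 ≤ r ^ 3 := pow_le_pow_right₀ hr.le (by norm_num)
  have hr34 : r ^ 3 ≤ r ^ 4 := pow_le_pow_right₀ hr.le (by norm_num)
  have hm31 : 31 * r ^ 2 ≤ (m : ℝ) := by nlinarith
  have hm' : (31 : ℝ) ≤ m := by linarith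
  have hm0 : (0 : ℝ) < m := by linarith
  have hl0 : (0 : ℝ) < ℓ := by linarith
  have hk0 : (0 : ℝ) < k := by linarith
  have hr0 : 0 < r := by linarith
  have hr4k : 1 ≤ r ^ 4 * k := by nlinarith
  have hr3k : r ^ 3 ≤ r ^ 3 * k := by nlinarith
  have hbeta : ((ℓ : ℝ) * m)⁻¹ + r * (30 * r ^ 3 * k / (ℓ * m)) ≤ 1 / ℓ := by
    have h2 : ((ℓ : ℝ) * m)⁻¹ + r * (30 * r ^ 3 * k / (ℓ * m))
        = ((1 + 30 * (r ^ 4 * k)) / m) * (1 / ℓ) := by field_simp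
    have h3 : (1 + 30 * (r ^ 4 * k)) / m ≤ 1 := by rw [div_le_one hm0]; nlinarith
    rw [h2]
    exact mul_le_of_le_one_left (by positivity) h3
  have hl2 : 1 / (ℓ : ℝ) ≤ 1 / 2 := one_div_le_one_div_of_le (by norm_num) hl'
  have hmin1 : r * min 1 (6 * r ^ 2 / ℓ * (k : ℝ)) ≤ r * (6 * r ^ 2 / ℓ * (k : ℝ)) :=
    mul_le_mul_of_nonneg_left (min_le_right _ _) hr0.le
  have hmin2 : r * min 1 (4 * r / ℓ) ≤ r * (4 * r / ℓ) :=
    mul_le_mul_of_nonneg_left (min_le_right _ _) hr0.le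
  have hlinv : 0 < 1 / (ℓ : ℝ) := by positivity
  refine res_ext (u := 30 * r ^ 3 * k / (ℓ * m)) (q := 6 * r ^ 2 / ℓ) (s := 4 * r / ℓ)
    hk (by omega) hm (by positivity) (by positivity)
    (by positivity) (by positivity) ?_ hr i y ?_ ?_ ?_ ?_
  · rw [div_le_one (by positivity)]; nlinarith
  · have h1 : 1 / (32 * r ^ 4 * k) * (r * (30 * r ^ 3 * k / (ℓ * m)))
        = ((ℓ : ℝ) * m)⁻¹ * (30 / 32) := by
      field_simp
    rw [h1]
    apply mul_lt_mul_of_pos_left _ (by positivity)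
    have : 1 / (32 * r ^ 4 * k) < 1 / 31 := by
      apply one_div_lt_one_div_of_lt (by norm_num); nlinarith
    linarith
  · have h1 : 15 * (r ^ 3 * k) * (1 / ℓ) ≤ ((m : ℝ) - 1) * (30 * r ^ 3 * k / (ℓ * m)) := by
      have : ((m : ℝ) - 1) * (30 * r ^ 3 * k / (ℓ * m))
        = (30 * (r ^ 3 * k)) * (1 / ℓ) * ((m - 1) / m) := by field_simp
      rw [this]
      have h2 : 1 / 2 ≤ ((m : ℝ) - 1) / m := by rw [le_div_iff₀ hm0]; linarith
      have h3 : 0 ≤ (30 * (r ^ 3 * k)) * (1 / (ℓ : ℝ)) := by positivity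
      nlinarith
    have h2 : r * (6 * r ^ 2 / ℓ * (k : ℝ)) + r * (4 * r / ℓ) + 1 / ℓ
        = (6 * (r ^ 3 * k) + 4 * r ^ 2 + 1) * (1 / ℓ) := by field_simp
    have h3 : (6 * (r ^ 3 * k) + 4 * r ^ 2 + 1) * (1 / (ℓ : ℝ)) < 15 * (r ^ 3 * k) * (1 / ℓ) :=
      mul_lt_mul_of_pos_right (by nlinarith) hlinv
    linarith
  · have h1 : r * (4 * r / ℓ) + 1 / ℓ = (4 * r ^ 2 + 1) * (1 / ℓ) := by field_simp
    have h2 : (4 * r ^ 2 + 1) * (1 / (ℓ : ℝ)) < 6 * r ^ 2 * (1 / ℓ) :=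
      mul_lt_mul_of_pos_right (by nlinarith) hlinv
    have h3 : 6 * r ^ 2 * (1 / (ℓ : ℝ)) = 6 * r ^ 2 / ℓ := by ring
    linarith
  · intro _
    have h1 : 2 * r ≤ ((ℓ : ℝ) - 1) * (4 * r / ℓ) := by
      rw [mul_div_assoc', le_div_iff₀ hl0]; nlinarith
    linarith

end superstar

lemma cube_bound (r : ℝ) (hr : 1 < r) (k ℓ m : ℕ) (hk : 0 < k) (hl : 0 < ℓ) (hm : 0 < m) :
    0 < extinctionProb r (outWeights (superstarOut k ℓ m)) (uniformSingleton (SuperstarV k ℓ m)) ∧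
    1 / ((192 * r ^ 5) ^ 3 * ((ℓ : ℝ) * (k + m) + 1)) ≤
      extinctionProb r (outWeights (superstarOut k ℓ m))
        (uniformSingleton (SuperstarV k ℓ m)) ^ 3 := by
  obtain ⟨hA, hB⟩ := boundA (k := k) (ℓ := ℓ) (m := m) hk hl hm hr
  set E := extinctionProb r (outWeights (superstarOut k ℓ m))
    (uniformSingleton (SuperstarV k ℓ m)) with hE
  have hl' : (1 : ℝ) ≤ ℓ := by exact_mod_cast hl
  have hk' : (1 : ℝ) ≤ k := by exact_mod_cast hk
  have hm' : (1 : ℝ) ≤ m := by exact_mod_cast hm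
  have hl0 : (0 : ℝ) < ℓ := by linarith
  have hk0 : (0 : ℝ) < k := by linarith
  have hm0 : (0 : ℝ) < m := by linarith
  have hr0 : 0 < r := by linarith
  set n : ℝ := (ℓ : ℝ) * (k + m) + 1 with hn
  have hlk : 1 ≤ (ℓ : ℝ) * k := by nlinarith
  have hlm : 1 ≤ (ℓ : ℝ) * m := by nlinarith
  have hn1 : 1 ≤ n := by rw [hn]; nlinarith
  have hn0 : 0 < n := by linarith
  have hr4 : 1 ≤ r ^ 4 := one_le_pow₀ hr.le
  have hr24 : r ^ 2 ≤ r ^ 4 := pow_le_pow_right₀ hr.le (by norm_num)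
  have hr14 : r ≤ r ^ 4 := by
    have := pow_le_pow_right₀ hr.le (show 1 ≤ 4 by norm_num); simpa using this
  have hr45 : r ^ 4 ≤ r ^ 5 := pow_le_pow_right₀ hr.le (by norm_num)
  have hr5 : 1 ≤ r ^ 5 := one_le_pow₀ hr.le
  have hEpos : 0 < E := lt_of_lt_of_le (by positivity) hA
  refine ⟨hEpos, ?_⟩
  set c : ℝ := 192 * r ^ 5 with hc
  have hc0 : 0 < c := by positivity
  have hcE0 : 0 < c * E := by positivity
  have hA' : (ℓ : ℝ) * k ≤ n * (2 + r) * E := by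
    have h1 : n⁻¹ * (ℓ * k * (1 / (2 + r))) = (ℓ * k) / (n * (2 + r)) := by field_simp
    rw [h1, div_le_iff₀ (by positivity)] at hA
    linarith
  suffices hs : 1 ≤ (c * E) ^ 3 * n by
    rw [div_le_iff₀ (by positivity)]
    calc 1 ≤ (c * E) ^ 3 * n := hs
      _ = E ^ 3 * (c ^ 3 * n) := by ring
  by_cases hkm : 31 * r ^ 4 * k ≤ m
  · have hkm' : (k : ℝ) ≤ m := by nlinarith
    have hn3 : n ≤ 3 * (ℓ * m) := by rw [hn]; nlinarith
    have hnlm : ℓ * m ≤ n := by rw [hn]; nlinarith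
    -- E ≥ k / (c m)
    have e1 : (k : ℝ) ≤ c * E * m := by
      have h1 : (ℓ : ℝ) * k ≤ ℓ * (3 * m * (2 + r) * E) := by
        have : n * ((2 + r) * E) ≤ 3 * (ℓ * m) * ((2 + r) * E) :=
          mul_le_mul_of_nonneg_right hn3 (by positivity)
        linarith
      have h2 := le_of_mul_le_mul_left h1 hl0
      have h3 : 3 * (2 + r) ≤ c := by rw [hc]; linarith
      have h4 : 3 * (2 + r) * (m * E) ≤ c * (m * E) :=
        mul_le_mul_of_nonneg_right h3 (by positivity)
      linarith
    have eb : ∀ d : ℝ, 0 < d → 3 * d ≤ c → ∀ z : ℝ, 0 < z →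
        n⁻¹ * (ℓ * m * (1 / (d * z))) ≤ E → 1 ≤ c * E * z := by
      intro d hd hdc z hz h
      have h1 : n⁻¹ * (ℓ * m * (1 / (d * z))) = (ℓ * m) / (n * (d * z)) := by field_simp
      rw [h1, div_le_iff₀ (by positivity)] at h
      have h2 : n * (E * (d * z)) ≤ 3 * (ℓ * m) * (E * (d * z)) :=
        mul_le_mul_of_nonneg_right hn3 (by positivity)
      have h3 : (ℓ * m : ℝ) * 1 ≤ (ℓ * m) * (3 * d * (E * z)) := by linarith
      have h4 := le_of_mul_le_mul_left h3 (by positivity)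
      have h5 : 3 * d * (E * z) ≤ c * (E * z) := mul_le_mul_of_nonneg_right hdc (by positivity)
      linarith
    have e2 : 1 ≤ c * E * ℓ :=
      eb (8 * r ^ 2) (by positivity) (by rw [hc]; linarith) ℓ hl0
        (hB _ fun i y => resB hk hl hm hr hkm i y)
    have e3 : 1 ≤ c * E * k := by
      by_cases h2 : 2 ≤ ℓ
      · exact eb (32 * r ^ 4) (by positivity) (by rw [hc]; linarith) k hk0
          (hB _ fun i y => resC hk h2 hm hr hkm i y)
      · have : ℓ = 1 := by omega
        subst this
        simp at e2
        nlinarith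
    have h12 : (k : ℝ) * 1 ≤ (c * E * m) * (c * E * ℓ) := by
      exact mul_le_mul e1 e2 (by norm_num) (by positivity)
    have h123 : (k : ℝ) * 1 * 1 ≤ (c * E * m) * (c * E * ℓ) * (c * E * k) :=
      mul_le_mul h12 e3 (by norm_num) (by positivity)
    have h4 : (k : ℝ) * 1 ≤ k * ((c * E) ^ 3 * (ℓ * m)) := by linarith
    have h5 := le_of_mul_le_mul_left h4 hk0
    have h6 : (c * E) ^ 3 * (ℓ * m) ≤ (c * E) ^ 3 * n :=
      mul_le_mul_of_nonneg_left hnlm (by positivity)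
    linarith
  · push Not at hkm
    have hnk : n ≤ 64 * r ^ 4 * (ℓ * k) := by
      have h1 : (ℓ : ℝ) * m ≤ ℓ * (31 * r ^ 4 * k) := mul_le_mul_of_nonneg_left hkm.le hl0.le
      have h2 : (ℓ : ℝ) * k ≤ r ^ 4 * (ℓ * k) := le_mul_of_one_le_left (by positivity) hr4
      rw [hn]
      nlinarith
    have h1 : n * ((2 + r) * E) ≤ 64 * r ^ 4 * (ℓ * k) * ((2 + r) * E) :=
      mul_le_mul_of_nonneg_right hnk (by positivity)
    have h2 : (ℓ * k : ℝ) * 1 ≤ (ℓ * k) * (64 * r ^ 4 * (2 + r) * E) := by linarith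
    have h3 := le_of_mul_le_mul_left h2 (by positivity)
    have h4 : 64 * r ^ 4 * (2 + r) ≤ c := by rw [hc]; nlinarith
    have h5 : 64 * r ^ 4 * (2 + r) * E ≤ c * E := mul_le_mul_of_nonneg_right h4 hEpos.le
    have h6 : 1 ≤ c * E := by linarith
    have h7 : 1 ≤ (c * E) ^ 3 := one_le_pow₀ h6
    nlinarith

/-- **Extinction lower bound for superstars** (Theorem 4.1).  For every `r > 1` there is
a constant `c > 0` such that for all positive integers `k`, `ℓ`, `m`, with
`n = ℓ(k+m)+1`, the discrete-time Moran process with fitness `r` on the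
`(k,ℓ,m)`-superstar, started from a single initial mutant at a uniformly random vertex,
has extinction probability at least `1 / (c · (n · log n)^{1/3})`. -/
theorem superstar_extinction_lower_bound (r : ℝ) (hr : 1 < r) :
    ∃ c : ℝ, 0 < c ∧ ∀ k ℓ m : ℕ, 0 < k → 0 < ℓ → 0 < m →
      ∀ n : ℕ, n = ℓ * (k + m) + 1 →
        1 / (c * ((n : ℝ) * Real.log (n : ℝ)) ^ ((1 : ℝ) / 3)) ≤
          extinctionProb r (outWeights (superstarOut k ℓ m))
            (uniformSingleton (SuperstarV k ℓ m)) := by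
  refine ⟨192 * r ^ 5, by positivity, ?_⟩
  intro k ℓ m hk hl hm n hn
  obtain ⟨hE, h3⟩ := cube_bound r hr k ℓ m hk hl hm
  set E := extinctionProb r (outWeights (superstarOut k ℓ m))
    (uniformSingleton (SuperstarV k ℓ m)) with hEdef
  have hr0 : 0 < r := by linarith
  have hnr : (n : ℝ) = (ℓ : ℝ) * (k + m) + 1 := by rw [hn]; push_cast; ring
  have hn3 : 3 ≤ n := by
    have : 1 * (1 + 1) ≤ ℓ * (k + m) := Nat.mul_le_mul hl (by omega)
    omega
  have hn3' : (3 : ℝ) ≤ n := by exact_mod_cast hn3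
  have hlog : 1 ≤ Real.log n := by
    rw [Real.le_log_iff_exp_le (by linarith)]
    linarith [Real.exp_one_lt_d9]
  rw [← hnr] at h3
  set c : ℝ := 192 * r ^ 5 with hc
  have hc0 : 0 < c := by positivity
  set X : ℝ := (n : ℝ) * Real.log n with hX
  have hX0 : 0 < X := by positivity
  have hnX : (n : ℝ) ≤ X := by rw [hX]; nlinarith
  have hroot : ((X ^ ((1 : ℝ) / 3)) : ℝ) ^ 3 = X := by
    rw [← Real.rpow_natCast, ← Real.rpow_mul hX0.le]
    norm_num
  have hXr : 0 < X ^ ((1 : ℝ) / 3) := Real.rpow_pos_of_pos hX0 _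
  apply le_of_pow_le_pow_left₀ (n := 3) (by norm_num) hE.le
  refine le_trans ?_ h3
  rw [div_pow, mul_pow, hroot, one_pow]
  apply one_div_le_one_div_of_le (by positivity)
  exact mul_le_mul_of_nonneg_left hnX (by positivity)
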